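/- The formal power series P(x) = Σ_{n≥0} [2·(3n)!/((n+1)!·(2n+1)!)]·xⁿ in ℚ[[x]] is algebraic over ℚ[x]: there exists a nonzero polynomial I in one variable y with coefficients in the polynomial ring ℚ[x] such that substituting P for y (with ℚ[x] mapped into ℚ[[x]] in the natural way) gives 0. -/

import Mathlib

/-- The generating function `P(x) = Σ_{n≥0} 2·(3n)!/((n+1)!·(2n+1)!) · xⁿ` in `ℚ[[x]]`,
enumerating 2-stack-sortable permutations by length. -/
noncomputable def westSeries : PowerSeries ℚ :=
  PowerSeries.mk fun n =>
    2 * (3 * n).factorial / ((n + 1).factorial * (2 * n + 1).factorial)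

open PowerSeries in
/-- Approximations to the power series solution of `B = 1 + X * B ^ 3`. -/
noncomputable def ternaryApprox : ℕ → PowerSeries ℚ
  | 0 => 0
  | n + 1 => 1 + X * ternaryApprox n ^ 3

open PowerSeries in
/-- The generating function of ternary trees. -/
noncomputable def ternarySeries : PowerSeries ℚ :=
  mk fun n => coeff n (ternaryApprox (n + 1))

open PowerSeries in
theorem X_pow_dvd_ternaryApprox_succ_sub (n : ℕ) :
    (X : PowerSeries ℚ) ^ n ∣ ternaryApprox (n + 1) - ternaryApprox n := by
  induction n with
  | zero => simp
  | succ n ih =>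
    have h : ternaryApprox (n + 1 + 1) - ternaryApprox (n + 1) =
        X * (ternaryApprox (n + 1) ^ 3 - ternaryApprox n ^ 3) := by
      rw [ternaryApprox, ternaryApprox.eq_2 n]
      ring
    rw [h, pow_succ']
    exact mul_dvd_mul_left _ (ih.trans (sub_dvd_pow_sub_pow _ _ 3))

open PowerSeries in
theorem X_pow_dvd_ternaryApprox_sub {m n : ℕ} (h : m ≤ n) :
    (X : PowerSeries ℚ) ^ m ∣ ternaryApprox n - ternaryApprox m := by
  induction n, h using Nat.le_induction with
  | base => simp
  | succ n hmn ih =>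
    have := dvd_add ((pow_dvd_pow X hmn).trans (X_pow_dvd_ternaryApprox_succ_sub n)) ih
    simpa using this

open PowerSeries in
theorem X_pow_dvd_ternarySeries_sub (n : ℕ) :
    (X : PowerSeries ℚ) ^ n ∣ ternarySeries - ternaryApprox n := by
  rw [X_pow_dvd_iff]
  intro m hm
  have h := X_pow_dvd_iff.1 (X_pow_dvd_ternaryApprox_sub (Nat.succ_le_of_lt hm)) m m.lt_succ_self
  rw [map_sub, sub_eq_zero] at h ⊢
  rw [ternarySeries, coeff_mk, h]

open PowerSeries in
theorem ternarySeries_eq : ternarySeries = 1 + X * ternarySeries ^ 3 := by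
  rw [← sub_eq_zero]
  ext n
  have h₁ := X_pow_dvd_ternarySeries_sub (n + 1 + 1)
  have h₂ : (X : PowerSeries ℚ) ^ (n + 1) ∣ ternarySeries ^ 3 - ternaryApprox (n + 1) ^ 3 :=
    (X_pow_dvd_ternarySeries_sub (n + 1)).trans (sub_dvd_pow_sub_pow _ _ 3)
  have h₃ : (X : PowerSeries ℚ) ^ (n + 1) ∣ ternarySeries - (1 + X * ternarySeries ^ 3) := by
    have h := dvd_sub ((pow_dvd_pow X (n + 1).le_succ).trans h₁) (h₂.mul_left X)
    rw [ternaryApprox] at h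
    convert h using 1
    ring
  simpa using X_pow_dvd_iff.1 h₃ n n.lt_succ_self

open PowerSeries in
/-- Coefficient form of a second-order linear differential equation at `0`. -/
theorem coeff_succ_of_differential_equation {f : PowerSeries ℚ}
    (hf : 4 * X ^ 2 * derivative ℚ (derivative ℚ f) + 10 * X * derivative ℚ f + 2 * f - 4 =
      X * (27 * X ^ 2 * derivative ℚ (derivative ℚ f) + 54 * X * derivative ℚ f + 6 * f)) :
    constantCoeff f = 2 ∧ ∀ n : ℕ, 2 * ((n : ℚ) + 2) * (2 * n + 3) * coeff (n + 1) f =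
      3 * (3 * n + 2) * (3 * n + 1) * coeff n f := by
  have hX : ∀ (g : PowerSeries ℚ) (n : ℕ),
      coeff n (X * derivative ℚ g) = n * coeff n g := by
    intro g n
    cases n with
    | zero => simp
    | succ n => rw [coeff_succ_X_mul, coeff_derivative]; push_cast; ring
  have hX2 : ∀ (g : PowerSeries ℚ) (n : ℕ),
      coeff n (X ^ 2 * derivative ℚ (derivative ℚ g)) = n * (n - 1) * coeff n g := by
    intro g n
    have : X ^ 2 * derivative ℚ (derivative ℚ g) =
        X * derivative ℚ (X * derivative ℚ g) - X * derivative ℚ g := by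
      simp only [Derivation.leibniz, derivative_X, smul_eq_mul]
      ring
    rw [this, map_sub, hX, hX]
    ring
  have hf' : C 4 * (X ^ 2 * derivative ℚ (derivative ℚ f)) + C 10 * (X * derivative ℚ f)
      + C 2 * f - C 4 = X * (C 27 * (X ^ 2 * derivative ℚ (derivative ℚ f))
        + C 54 * (X * derivative ℚ f) + C 6 * f) := by
    simp only [map_ofNat]
    linear_combination hf
  constructor
  · have := congrArg constantCoeff hf'
    simp at this
    linarith
  · intro n
    have := congrArg (coeff (n + 1)) hf'
    simp only [coeff_succ_X_mul, map_add, map_sub, coeff_C_mul, hX, hX2, coeff_C,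
      Nat.succ_ne_zero, if_false] at this
    push_cast at this
    linear_combination this

theorem coeff_succ_westSeries (n : ℕ) :
    2 * ((n : ℚ) + 2) * (2 * n + 3) * PowerSeries.coeff (n + 1) westSeries =
      3 * (3 * n + 2) * (3 * n + 1) * PowerSeries.coeff n westSeries := by
  have h₁ : 3 * (n + 1) = 3 * n + 1 + 1 + 1 := by ring
  have h₂ : 2 * (n + 1) = 2 * n + 1 + 1 := by ring
  simp only [westSeries, PowerSeries.coeff_mk, h₁, h₂, Nat.factorial_succ]
  push_cast
  field_simp
  ring

open PowerSeries in
theorem westSeries_eq : westSeries = 3 * ternarySeries - ternarySeries ^ 2 := by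
  set B := ternarySeries
  have h : X * B ^ 3 - B + 1 = 0 := by linear_combination -ternarySeries_eq
  have hE : (1 : PowerSeries ℚ) - 3 * X * B ^ 2 ≠ 0 := by
    intro h0
    simpa using congrArg constantCoeff h0
  have hD : derivative ℚ B * (1 - 3 * X * B ^ 2) = B ^ 3 := by
    have := congrArg (derivative ℚ) h
    simp only [map_add, map_sub, map_zero, Derivation.leibniz, Derivation.leibniz_pow,
      derivative_X, smul_eq_mul, Derivation.map_one_eq_zero, nsmul_eq_mul] at this
    push_cast at this
    linear_combination -this
  have hP : derivative ℚ (3 * B - B ^ 2) = B ^ 4 := by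
    have h3 : derivative ℚ (3 : PowerSeries ℚ) = 0 := (derivative ℚ).map_natCast 3
    simp only [map_sub, Derivation.leibniz, Derivation.leibniz_pow, h3, smul_eq_mul,
      nsmul_eq_mul]
    push_cast
    linear_combination B * hD + 3 * derivative ℚ B * h
  have hode := coeff_succ_of_differential_equation (f := 3 * B - B ^ 2) (by
    rw [hP, Derivation.leibniz_pow]
    simp only [smul_eq_mul, nsmul_eq_mul]
    push_cast
    apply mul_right_cancel₀ hE
    linear_combination (4 * X ^ 2 * B ^ 3 * (4 - 27 * X)) * hD
      + (54 * B ^ 3 * X ^ 2 - (14 * B ^ 3 + 18 * B) * X + 2 * B - 4) * h)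
  ext n
  induction n with
  | zero =>
    rw [coeff_zero_eq_constantCoeff_apply (3 * B - B ^ 2), hode.1]
    simp [westSeries, -coeff_zero_eq_constantCoeff]
  | succ n ih =>
    have hn : 2 * ((n : ℚ) + 2) * (2 * n + 3) ≠ 0 := by positivity
    apply mul_left_cancel₀ hn
    rw [coeff_succ_westSeries, hode.2, ih]

theorem westSeries_algebraic :
    ∃ I : Polynomial (Polynomial ℚ),
      I ≠ 0 ∧ Polynomial.eval₂ Polynomial.coeToPowerSeries.ringHom westSeries I = 0 := by
  let x : Polynomial (Polynomial ℚ) := Polynomial.C Polynomial.X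
  let y : Polynomial (Polynomial ℚ) := Polynomial.X
  refine ⟨(3 * x * y - 1) ^ 2 - 3 * (3 * x * y - 1) * (9 * x - x * y - 1)
    + y * (9 * x - x * y - 1) ^ 2, fun h => ?_, ?_⟩
  · have := congrArg (fun p => Polynomial.eval 0 (Polynomial.eval 0 p)) h
    norm_num [x, y] at this
  · simp only [x, y, Polynomial.eval₂_add, Polynomial.eval₂_sub, Polynomial.eval₂_mul,
      Polynomial.eval₂_pow, Polynomial.eval₂_C, Polynomial.eval₂_X, Polynomial.eval₂_one,
      Polynomial.eval₂_ofNat, Polynomial.coeToPowerSeries.ringHom_apply, Polynomial.coe_X]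
    have h := ternarySeries_eq
    rw [westSeries_eq]
    set B := ternarySeries
    set M : PowerSeries ℚ :=
      9 * PowerSeries.X - PowerSeries.X * (3 * B - B ^ 2) - 1 with hM
    have hN : 3 * PowerSeries.X * (3 * B - B ^ 2) - 1 = B * M := by
      rw [hM]
      linear_combination h
    rw [hN]
    ring
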